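/- Let K be a number field, φ ∈ K(X) a rational function of degree d ≥ 2 which is not of the form β·X^{±d} with β ∈ K*, and let α ∈ ℚ̄ be a non-preperiodic point for φ with α not a root of unity. Then there are only finitely many positive integers n such that α and φ^{(n)}(α) are multiplicatively dependent (i.e., α^{k₁}·(φ^{(n)}(α))^{k₂} = 1 for some integers (k₁,k₂) ≠ (0,0)). -/

import Mathlib

open intervalIntegral in
theorem integral_pow_mul_one_sub_pow (p q : ℕ) :
    ∫ t in (0:ℝ)..1, t ^ p * (1 - t) ^ q = (p.factorial * q.factorial : ℝ) / (p + q + 1).factorial := by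
  induction q generalizing p with
  | zero =>
    simp [Nat.factorial_succ]
    field_simp
  | succ q ih =>
    have h := integral_mul_deriv_eq_deriv_mul (a := (0:ℝ)) (b := 1)
      (u := fun t => (1 - t) ^ (q + 1)) (v := fun t => t ^ (p + 1) / (p + 1 : ℝ))
      (u' := fun t => -((q + 1 : ℝ) * (1 - t) ^ q)) (v' := fun t => t ^ p)
      (fun x _ => by
        have := ((hasDerivAt_id x).const_sub 1).fun_pow (q + 1)
        simpa using this)
      (fun x _ => by
        have := ((hasDerivAt_id x).fun_pow (p + 1)).div_const (p + 1 : ℝ)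
        have hp : (p + 1 : ℝ) ≠ 0 := by positivity
        refine this.congr_deriv ?_
        simp only [id_eq, Nat.cast_add, Nat.cast_one, add_tsub_cancel_right]
        field_simp)
      (Continuous.intervalIntegrable (by fun_prop) _ _)
      (Continuous.intervalIntegrable (by fun_prop) _ _)
    have e : ∫ t in (0:ℝ)..1, -((q + 1 : ℝ) * (1 - t) ^ q) * (t ^ (p + 1) / (p + 1 : ℝ)) =
        -((q + 1 : ℝ) / (p + 1)) * ∫ t in (0:ℝ)..1, t ^ (p + 1) * (1 - t) ^ q := by
      rw [← integral_const_mul]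
      congr 1; ext t; field_simp
    rw [e, ih] at h
    have e2 : ∫ t in (0:ℝ)..1, t ^ p * (1 - t) ^ (q + 1) =
      ∫ t in (0:ℝ)..1, (1 - t) ^ (q + 1) * t ^ p := by
      congr 1; ext t; ring
    rw [e2, h, show p + 1 + q + 1 = p + (q + 1) + 1 by ring, Nat.factorial_succ q,
      Nat.factorial_succ p]
    have : ((p + (q + 1) + 1).factorial : ℝ) ≠ 0 := by positivity
    push_cast
    simp
    field_simp

open Polynomial in
/-- The polynomial `∑ₖ (a+k choose a) (N choose b-k) (-X)ᵏ`. -/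
noncomputable def padeNum (a b N : ℕ) : ℤ[X] :=
  ∑ k ∈ Finset.range (b + 1), C (((a + k).choose a * N.choose (b - k) : ℕ) : ℤ) * (-X) ^ k

open Polynomial in
/-- The reversal of `padeNum`. -/
noncomputable def padeConst (a c N : ℕ) : ℤ[X] :=
  ∑ k ∈ Finset.range (c + 1),
    C (((a + k).choose a * N.choose (c - k) : ℕ) : ℤ) * ((-1) ^ k * X ^ (c - k))

theorem choose_mul_factorial_div (a b c k : ℕ) (hk : k ≤ b) :
    (b.choose k : ℝ) * (((a + k).factorial * c.factorial : ℝ) / (a + k + c + 1).factorial) =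
      (a.factorial * b.factorial * c.factorial : ℝ) / (a + b + c + 1).factorial *
        ((a + k).choose a * (a + b + c + 1).choose (b - k) : ℕ) := by
  rw [Nat.cast_mul, Nat.cast_choose ℝ hk, Nat.cast_choose ℝ (Nat.le_add_right a k),
    Nat.cast_choose ℝ (show b - k ≤ a + b + c + 1 by omega),
    show a + b + c + 1 - (b - k) = a + k + c + 1 by omega, Nat.add_sub_cancel_left]
  field_simp

open Polynomial intervalIntegral in
theorem integral_zero_left (a b c : ℕ) (z : ℝ) :
    ∫ s in (0:ℝ)..z, s ^ a * (1 - s) ^ b * (z - s) ^ c =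
      (a.factorial * b.factorial * c.factorial : ℝ) / (a + b + c + 1).factorial *
        (z ^ (a + c + 1) * aeval z (padeNum a b (a + b + c + 1))) := by
  have h1 := intervalIntegral.smul_integral_comp_mul_left (a := 0) (b := 1)
    (fun s => s ^ a * (1 - s) ^ b * (z - s) ^ c) z
  simp only [mul_zero, mul_one] at h1
  rw [← h1]
  have h2 : ∀ t : ℝ, (z * t) ^ a * (1 - z * t) ^ b * (z - z * t) ^ c =
      ∑ k ∈ Finset.range (b + 1), (z ^ (a + c) * (-z) ^ k * (b.choose k : ℝ)) *
        (t ^ (a + k) * (1 - t) ^ c) := by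
    intro t
    rw [show (1 - z * t) = -(z * t) + 1 by ring, add_pow, Finset.mul_sum, Finset.sum_mul]
    refine Finset.sum_congr rfl fun k _ => ?_
    rw [show z - z * t = z * (1 - t) by ring, mul_pow, mul_pow, neg_pow (z * t), neg_pow z,
      mul_pow]
    ring
  simp_rw [h2]
  rw [integral_finsetSum fun i _ => Continuous.intervalIntegrable (by fun_prop) _ _]
  simp_rw [integral_const_mul, integral_pow_mul_one_sub_pow]
  rw [padeNum, map_sum, smul_eq_mul, Finset.mul_sum, Finset.mul_sum, Finset.mul_sum]
  refine Finset.sum_congr rfl fun k hk => ?_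
  have hk : k ≤ b := by simpa [Nat.lt_succ_iff] using hk
  have := choose_mul_factorial_div a b c k hk
  simp only [map_mul, map_pow, map_neg, aeval_X, map_natCast]
  linear_combination (z * z ^ (a + c) * (-z) ^ k) * this

open Polynomial intervalIntegral in
theorem integral_zero_one (a b c : ℕ) (z : ℝ) :
    ∫ s in (0:ℝ)..1, s ^ a * (1 - s) ^ b * (z - s) ^ c =
      (a.factorial * b.factorial * c.factorial : ℝ) / (a + b + c + 1).factorial *
        aeval z (padeConst a c (a + b + c + 1)) := by
  have h2 : ∀ t : ℝ, t ^ a * (1 - t) ^ b * (z - t) ^ c =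
      ∑ k ∈ Finset.range (c + 1), ((-1) ^ k * z ^ (c - k) * (c.choose k : ℝ)) *
        (t ^ (a + k) * (1 - t) ^ b) := by
    intro t
    rw [show (z - t) = -t + z by ring, add_pow, Finset.mul_sum]
    refine Finset.sum_congr rfl fun k _ => ?_
    rw [neg_pow t]
    ring
  simp_rw [h2]
  rw [integral_finsetSum fun i _ => Continuous.intervalIntegrable (by fun_prop) _ _]
  simp_rw [integral_const_mul, integral_pow_mul_one_sub_pow]
  rw [padeConst, map_sum, Finset.mul_sum]
  refine Finset.sum_congr rfl fun k hk => ?_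
  have hk : k ≤ c := by simpa [Nat.lt_succ_iff] using hk
  have := choose_mul_factorial_div a c b k hk
  rw [show a + c + b + 1 = a + b + c + 1 by ring] at this
  simp only [map_mul, map_pow, map_neg, aeval_X, map_natCast, map_one]
  linear_combination ((-1) ^ k * z ^ (c - k)) * this

open Polynomial intervalIntegral in
theorem integral_one_right (a b c : ℕ) (z : ℝ) :
    ∫ s in z..1, s ^ a * (1 - s) ^ b * (z - s) ^ c =
      (a.factorial * b.factorial * c.factorial : ℝ) / (a + b + c + 1).factorial *
        ((-1) ^ c * ((1 - z) ^ (b + c + 1) * aeval (1 - z) (padeNum b a (a + b + c + 1)))) := by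
  have h1 := intervalIntegral.integral_comp_sub_left (a := 0) (b := 1 - z)
    (fun s => s ^ a * (1 - s) ^ b * (z - s) ^ c) 1
  simp only [sub_sub_cancel, sub_zero] at h1
  rw [← h1]
  have h2 : ∀ t : ℝ, (1 - t) ^ a * t ^ b * (z - (1 - t)) ^ c =
      (-1) ^ c * (t ^ b * (1 - t) ^ a * ((1 - z) - t) ^ c) := by
    intro t
    rw [show z - (1 - t) = (-1) * ((1 - z) - t) by ring, mul_pow]
    ring
  simp_rw [h2]
  rw [integral_const_mul, integral_zero_left, show b + a + c + 1 = a + b + c + 1 by ring]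
  ring

open Polynomial intervalIntegral in
theorem pade_identity (a b c : ℕ) :
    X ^ (a + c + 1) * padeNum a b (a + b + c + 1) +
      (1 - X) ^ (b + c + 1) * ((-1) ^ c * (padeNum b a (a + b + c + 1)).comp (1 - X)) =
      padeConst a c (a + b + c + 1) := by
  apply Polynomial.map_injective (Int.castRingHom ℝ) Int.cast_injective
  refine Polynomial.funext fun z => ?_
  have h := integral_add_adjacent_intervals (a := 0) (b := z) (c := 1)
    (f := fun s : ℝ => s ^ a * (1 - s) ^ b * (z - s) ^ c) (μ := MeasureTheory.volume)
    (Continuous.intervalIntegrable (by fun_prop) _ _)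
    (Continuous.intervalIntegrable (by fun_prop) _ _)
  rw [integral_zero_left, integral_zero_one, integral_one_right, ← mul_add] at h
  have h0 : (a.factorial * b.factorial * c.factorial : ℝ) / (a + b + c + 1).factorial ≠ 0 := by
    positivity
  have h := mul_left_cancel₀ h0 h
  have e : ∀ p : ℤ[X], eval z (p.map (Int.castRingHom ℝ)) = aeval z p := by
    intro p; simp [aeval_def, eval₂_eq_eval_map]
  simp only [e, map_add, map_mul, map_pow, map_sub, map_one, aeval_X, aeval_comp, map_neg]
  linear_combination h

open Polynomial in
theorem natDegree_padeNum_le (a b N : ℕ) : (padeNum a b N).natDegree ≤ b := by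
  refine natDegree_sum_le_of_forall_le _ _ fun k hk => ?_
  have hk : k ≤ b := by simpa [Nat.lt_succ_iff] using hk
  refine (natDegree_C_mul_le _ _).trans (natDegree_pow_le.trans ?_)
  simpa using hk

open Polynomial in
theorem coeff_padeNum (a b N : ℕ) : (padeNum a b N).coeff b = (a + b).choose a * (-1) ^ b := by
  rw [padeNum, finsetSum_coeff, Finset.sum_range_succ, Finset.sum_eq_zero]
  · rw [neg_pow, zero_add, coeff_C_mul, ← C_1, ← C_neg, ← C_pow, coeff_C_mul, coeff_X_pow, if_pos rfl,
      Nat.sub_self, Nat.choose_zero_right]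
    simp
  · intro k hk
    have hk : k < b := by simpa using hk
    refine coeff_eq_zero_of_natDegree_lt ?_
    refine (natDegree_C_mul_le _ _).trans_lt (natDegree_pow_le.trans_lt ?_)
    simpa using hk

open Polynomial in
theorem natDegree_padeConst_le (a c N : ℕ) : (padeConst a c N).natDegree ≤ c := by
  refine natDegree_sum_le_of_forall_le _ _ fun k _ => ?_
  refine (natDegree_C_mul_le _ _).trans ?_
  rw [← C_1, ← C_neg, ← C_pow]
  exact (natDegree_C_mul_X_pow_le _ _).trans (Nat.sub_le _ _)

open Polynomial in
theorem coeff_padeConst (a c N : ℕ) : (padeConst a c N).coeff c = N.choose c := by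
  rw [padeConst, finsetSum_coeff, Finset.sum_range_succ', Finset.sum_eq_zero]
  · simp [-eq_intCast, -map_natCast, coeff_C_mul]
  · intro k hk
    have hk : k < c := by simpa using hk
    refine coeff_eq_zero_of_natDegree_lt ?_
    refine (natDegree_C_mul_le _ _).trans_lt ?_
    rw [← C_1, ← C_neg, ← C_pow]
    exact (natDegree_C_mul_X_pow_le _ _).trans_lt (by omega)

theorem AbsoluteValue.map_natCast_le {L : Type*} [Field L] (v : AbsoluteValue L ℝ) (n : ℕ) :
    v n ≤ n := by
  induction n with
  | zero => simp
  | succ n ih => push_cast; exact (v.add_le _ _).trans (by simpa using ih)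

theorem choose_mul_choose_le {a b N k : ℕ} (hk : k ≤ b) (hN : a + b ≤ N) :
    (((a + k).choose a * N.choose (b - k) : ℕ) : ℝ) ≤ 4 ^ N := by
  have h1 : (a + k).choose a ≤ 2 ^ N :=
    (Nat.choose_le_two_pow _ _).trans (Nat.pow_le_pow_right (by norm_num) (by omega))
  have h2 : N.choose (b - k) ≤ 2 ^ N := Nat.choose_le_two_pow _ _
  calc (((a + k).choose a * N.choose (b - k) : ℕ) : ℝ) ≤ ((2 ^ N * 2 ^ N : ℕ) : ℝ) :=
        Nat.cast_le.mpr (Nat.mul_le_mul h1 h2)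
    _ = 4 ^ N := by push_cast; rw [← mul_pow]; norm_num

open Polynomial in
theorem abv_aeval_padeNum_le {L : Type*} [Field L] (v : AbsoluteValue L ℝ) {a b N : ℕ}
    (hN : a + b + 1 ≤ N) (x : L) : v (aeval x (padeNum a b N)) ≤ 8 ^ N * max 1 (v x) ^ b := by
  rw [padeNum, map_sum]
  have hle : ∀ k ∈ Finset.range (b + 1),
      v (aeval x (C (((a + k).choose a * N.choose (b - k) : ℕ) : ℤ) * (-X) ^ k)) ≤
        4 ^ N * max 1 (v x) ^ b := fun k hk => by
    have hk : k ≤ b := by simpa [Nat.lt_succ_iff] using hk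
    simp only [map_mul, map_pow, map_neg, aeval_X, map_natCast,
      AbsoluteValue.map_neg]
    refine mul_le_mul ((v.map_natCast_le _).trans (choose_mul_choose_le hk (by omega))) ?_
      (by positivity) (by positivity)
    exact (pow_le_pow_left₀ (v.nonneg x) (le_max_right _ _) k).trans
      (pow_le_pow_right₀ (le_max_left _ _) hk)
  refine (v.sum_le _ _).trans ((Finset.sum_le_card_nsmul _ _ _ hle).trans ?_)
  rw [Finset.card_range, nsmul_eq_mul, ← mul_assoc]
  gcongr
  have : ((b + 1 : ℕ) : ℝ) ≤ 2 ^ N := by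
    exact_mod_cast (show b + 1 ≤ N by omega).trans Nat.lt_two_pow_self.le
  calc ((b + 1 : ℕ) : ℝ) * 4 ^ N ≤ 2 ^ N * 4 ^ N := by gcongr
    _ = 8 ^ N := by rw [← mul_pow]; norm_num

open Polynomial in
theorem abv_aeval_padeConst_le {L : Type*} [Field L] (v : AbsoluteValue L ℝ) {a c N : ℕ}
    (hN : a + c + 1 ≤ N) (x : L) : v (aeval x (padeConst a c N)) ≤ 8 ^ N * max 1 (v x) ^ c := by
  rw [padeConst, map_sum]
  have hle : ∀ k ∈ Finset.range (c + 1),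
      v (aeval x (C (((a + k).choose a * N.choose (c - k) : ℕ) : ℤ) *
        ((-1) ^ k * X ^ (c - k)))) ≤ 4 ^ N * max 1 (v x) ^ c := fun k hk => by
    have hk : k ≤ c := by simpa [Nat.lt_succ_iff] using hk
    simp only [map_mul, map_pow, map_neg, aeval_X, map_natCast,
      AbsoluteValue.map_neg, map_one, one_pow, one_mul]
    refine mul_le_mul ((v.map_natCast_le _).trans (choose_mul_choose_le hk (by omega))) ?_
      (by positivity) (by positivity)
    exact (pow_le_pow_left₀ (v.nonneg x) (le_max_right _ _) _).trans
      (pow_le_pow_right₀ (le_max_left _ _) (Nat.sub_le _ _))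
  refine (v.sum_le _ _).trans ((Finset.sum_le_card_nsmul _ _ _ hle).trans ?_)
  rw [Finset.card_range, nsmul_eq_mul, ← mul_assoc]
  gcongr
  have : ((c + 1 : ℕ) : ℝ) ≤ 2 ^ N := by
    exact_mod_cast (show c + 1 ≤ N by omega).trans Nat.lt_two_pow_self.le
  calc ((c + 1 : ℕ) : ℝ) * 4 ^ N ≤ 2 ^ N * 4 ^ N := by gcongr
    _ = 8 ^ N := by rw [← mul_pow]; norm_num

open Polynomial in
/-- The determinant of two neighbouring Padé approximants is a nonzero constant multiple of
`(1 - X) ^ (2 * n + 1)`. -/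
theorem pade_det (n : ℕ) (hn : 1 ≤ n) :
    ∃ l : ℤ, l ≠ 0 ∧
      padeNum n n (3 * n + 1) * padeConst (n + 1) (n - 1) (3 * n + 2) -
        padeNum (n + 1) (n + 1) (3 * n + 2) * padeConst n n (3 * n + 1) =
        C l * (1 - X) ^ (2 * n + 1) := by
  have h1 := pade_identity n n n
  have h2 := pade_identity (n + 1) (n + 1) (n - 1)
  rw [show n + n + n + 1 = 3 * n + 1 by ring, show n + n + 1 = 2 * n + 1 by ring] at h1
  rw [show n + 1 + (n + 1) + (n - 1) + 1 = 3 * n + 2 by omega,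
    show n + 1 + (n - 1) + 1 = 2 * n + 1 by omega] at h2
  set A₁ := padeNum n n (3 * n + 1)
  set A₂ := padeNum (n + 1) (n + 1) (3 * n + 2)
  set C₁ := padeConst n n (3 * n + 1)
  set C₂ := padeConst (n + 1) (n - 1) (3 * n + 2)
  obtain ⟨B₁, hB₁⟩ : ∃ B, B = (-1) ^ n * A₁.comp (1 - X) := ⟨_, rfl⟩
  obtain ⟨B₂, hB₂⟩ : ∃ B, B = (-1) ^ (n - 1) * A₂.comp (1 - X) := ⟨_, rfl⟩
  rw [← hB₁] at h1
  rw [← hB₂] at h2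
  have hD : A₁ * C₂ - A₂ * C₁ = (A₁ * B₂ - A₂ * B₁) * (1 - X) ^ (2 * n + 1) := by
    rw [← h1, ← h2]; ring
  have hA₁ : A₁.natDegree ≤ n := natDegree_padeNum_le _ _ _
  have hA₂ : A₂.natDegree ≤ n + 1 := natDegree_padeNum_le _ _ _
  have hC₁ : C₁.natDegree ≤ n := natDegree_padeConst_le _ _ _
  have hC₂ : C₂.natDegree ≤ n - 1 := natDegree_padeConst_le _ _ _
  have hdeg : (A₁ * C₂ - A₂ * C₁).natDegree ≤ 2 * n + 1 :=
    (natDegree_sub_le _ _).trans (max_le (natDegree_mul_le.trans (by omega))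
      (natDegree_mul_le.trans (by omega)))
  have hcoeff : (A₁ * C₂ - A₂ * C₁).coeff (2 * n + 1) ≠ 0 := by
    rw [coeff_sub, coeff_eq_zero_of_natDegree_lt (natDegree_mul_le.trans_lt (by omega)),
      show 2 * n + 1 = (n + 1) + n by ring, coeff_mul_add_eq_of_natDegree_le hA₂ hC₁, coeff_padeNum,
      coeff_padeConst]
    have e1 := (Nat.choose_pos (show n + 1 ≤ n + 1 + (n + 1) by omega)).ne'
    have e2 := (Nat.choose_pos (show n ≤ 3 * n + 1 by omega)).ne'
    simp [e1, e2]
  have hD0 : A₁ * C₂ - A₂ * C₁ ≠ 0 := fun h => hcoeff (by rw [h, coeff_zero])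
  have hX : (1 - X : ℤ[X]).natDegree = 1 := by
    rw [← neg_sub, natDegree_neg, ← C_1, natDegree_X_sub_C]
  have hlam0 : A₁ * B₂ - A₂ * B₁ ≠ 0 := fun h => hD0 (by rw [hD, h, zero_mul])
  have hX0 : (1 - X : ℤ[X]) ≠ 0 := fun h => by rw [h] at hX; simp at hX
  have hlam : (A₁ * B₂ - A₂ * B₁).natDegree = 0 := by
    rw [hD, natDegree_mul hlam0 (pow_ne_zero _ hX0), natDegree_pow, hX] at hdeg
    omega
  rw [eq_C_of_natDegree_eq_zero hlam] at hD hlam0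
  exact ⟨_, fun h => hlam0 (by rw [h, C_0]), hD⟩

theorem Subring.aeval_int_mem {L : Type*} [Field L] (O : Subring L) {x : L} (hx : x ∈ O)
    (p : Polynomial ℤ) : Polynomial.aeval x p ∈ O := by
  rw [Polynomial.aeval_eq_sum_range]
  exact O.sum_mem fun i _ => O.zsmul_mem (O.pow_mem hx i) _

/-- For `x + y = 1` and any `(η, θ)`, one of two neighbouring Padé approximants yields a nonzero
linear form in `x ^ M`, `y ^ M` with small coefficients when combined with `η x^M + θ y^M = 1`. -/
theorem exists_pade_combination {L : Type*} [Field L] [CharZero L] (n : ℕ) (hn : 1 ≤ n)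
    {x y η θ : L} (hxy : x + y = 1) (hx : x ≠ 0) (hy : y ≠ 0)
    (h : η * x ^ (2 * n + 1) + θ * y ^ (2 * n + 1) = 1) :
    ∃ a b c : L, (a - η * c) * x ^ (2 * n + 1) + (b - θ * c) * y ^ (2 * n + 1) = 0 ∧
      a - η * c ≠ 0 ∧ b - θ * c ≠ 0 ∧
      (∀ O : Subring L, x ∈ O → a ∈ O ∧ b ∈ O ∧ c ∈ O) ∧
      ∀ v : AbsoluteValue L ℝ, max (v a) (max (v b) (v c)) ≤
        8 ^ (3 * n + 2) * 2 ^ (n + 1) * max 1 (v x) ^ (n + 1) := by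
  have hy1 : 1 - x = y := by rw [← hxy]; ring
  have key : ∀ p q r : ℕ, p + r = 2 * n → q = p → q ≤ n + 1 → r ≤ n + 1 → p + q + r + 1 ≤ 3 * n + 2 →
      ∃ a b c : L, a = Polynomial.aeval x (padeNum p q (p + q + r + 1)) ∧
        c = Polynomial.aeval x (padeConst p r (p + q + r + 1)) ∧
        a * x ^ (2 * n + 1) + b * y ^ (2 * n + 1) = c ∧
        (∀ O : Subring L, x ∈ O → a ∈ O ∧ b ∈ O ∧ c ∈ O) ∧
        ∀ v : AbsoluteValue L ℝ, max (v a) (max (v b) (v c)) ≤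
          8 ^ (3 * n + 2) * 2 ^ (n + 1) * max 1 (v x) ^ (n + 1) := by
    intro p q r hp hq hqn hr hN
    have hid := congrArg (Polynomial.aeval x) (pade_identity p q r)
    simp only [map_add, map_mul, map_pow, map_sub, map_one, Polynomial.aeval_X,
      Polynomial.aeval_comp, map_neg, hy1] at hid
    rw [show p + r + 1 = 2 * n + 1 by omega, show q + r + 1 = 2 * n + 1 by omega] at hid
    refine ⟨_, (-1) ^ r * Polynomial.aeval y (padeNum q p (p + q + r + 1)), _, rfl, rfl, ?_, ?_, ?_⟩
    · rw [← hid]; ring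
    · intro O hO
      have hyO : y ∈ O := hy1 ▸ O.sub_mem O.one_mem hO
      exact ⟨O.aeval_int_mem hO _, O.mul_mem (O.pow_mem (O.neg_mem O.one_mem) _)
        (O.aeval_int_mem hyO _), O.aeval_int_mem hO _⟩
    · intro v
      have h8 : (8 : ℝ) ^ (p + q + r + 1) ≤ 8 ^ (3 * n + 2) := pow_le_pow_right₀ (by norm_num) hN
      have h1 : (1 : ℝ) ≤ 2 ^ (n + 1) := one_le_pow₀ (by norm_num)
      have hm : (1 : ℝ) ≤ max 1 (v x) := le_max_left _ _
      refine max_le ?_ (max_le ?_ ?_)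
      · refine (abv_aeval_padeNum_le v (by omega) x).trans ?_
        refine mul_le_mul ?_ (pow_le_pow_right₀ hm hqn) (by positivity) (by positivity)
        calc (8 : ℝ) ^ (p + q + r + 1) ≤ 8 ^ (3 * n + 2) * 1 := by rwa [mul_one]
          _ ≤ _ := by gcongr
      · have hvy : max 1 (v y) ≤ 2 * max 1 (v x) := by
          refine max_le (by linarith) ?_
          have := v.sub_le_add 1 x
          rw [hy1, map_one] at this
          linarith [le_max_right 1 (v x)]
        rw [map_mul, map_pow, AbsoluteValue.map_neg, map_one, one_pow, one_mul]
        refine (abv_aeval_padeNum_le v (by omega) y).trans ?_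
        calc (8 : ℝ) ^ (p + q + r + 1) * max 1 (v y) ^ p
            ≤ 8 ^ (3 * n + 2) * (2 * max 1 (v x)) ^ (n + 1) := by
              refine mul_le_mul h8 ?_ (by positivity) (by positivity)
              exact (pow_le_pow_left₀ (by positivity) hvy p).trans
                (pow_le_pow_right₀ (by linarith) (by omega))
          _ = _ := by rw [mul_pow]; ring
      · refine (abv_aeval_padeConst_le v (by omega) x).trans ?_
        refine mul_le_mul ?_ (pow_le_pow_right₀ hm hr) (by positivity) (by positivity)
        calc (8 : ℝ) ^ (p + q + r + 1) ≤ 8 ^ (3 * n + 2) * 1 := by rwa [mul_one]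
          _ ≤ _ := by gcongr
  obtain ⟨a₁, b₁, c₁, ha₁, hc₁, hid₁, hO₁, hv₁⟩ := key n n n (by omega) rfl (by omega) (by omega)
    (by omega)
  obtain ⟨a₂, b₂, c₂, ha₂, hc₂, hid₂, hO₂, hv₂⟩ := key (n + 1) (n + 1) (n - 1) (by omega) rfl (by omega)
    (by omega) (by omega)
  obtain ⟨l, hl, hdet⟩ := pade_det n hn
  rw [show n + n + n + 1 = 3 * n + 1 by ring] at ha₁ hc₁
  rw [show n + 1 + (n + 1) + (n - 1) + 1 = 3 * n + 2 by omega] at ha₂ hc₂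
  have hdet := congrArg (Polynomial.aeval x) hdet
  simp only [map_sub, map_mul, map_pow, map_one, Polynomial.aeval_X, hy1, ← ha₁, ← hc₁, ← ha₂,
    ← hc₂, eq_intCast, map_intCast] at hdet
  have hne : a₁ * c₂ - a₂ * c₁ ≠ 0 := by
    rw [hdet]
    exact mul_ne_zero (Int.cast_ne_zero.mpr hl) (pow_ne_zero _ hy)
  have hrel : ∀ a b c : L, a * x ^ (2 * n + 1) + b * y ^ (2 * n + 1) = c →
      (a - η * c) * x ^ (2 * n + 1) + (b - θ * c) * y ^ (2 * n + 1) = 0 := by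
    intro a b c hc
    linear_combination hc - c * h
  have hxM := pow_ne_zero (2 * n + 1) hx
  have hyM := pow_ne_zero (2 * n + 1) hy
  have hfin : ∀ a b c : L, a * x ^ (2 * n + 1) + b * y ^ (2 * n + 1) = c → a - η * c ≠ 0 →
      b - θ * c ≠ 0 := by
    intro a b c hc ha hb
    have := hrel a b c hc
    rw [hb, zero_mul, add_zero] at this
    exact (mul_ne_zero ha hxM) this
  by_cases h₁ : a₁ - η * c₁ = 0
  · have h₂ : a₂ - η * c₂ ≠ 0 := fun h₂ => hne (by linear_combination c₂ * h₁ - c₁ * h₂)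
    exact ⟨a₂, b₂, c₂, hrel _ _ _ hid₂, h₂, hfin _ _ _ hid₂ h₂, hO₂, hv₂⟩
  · exact ⟨a₁, b₁, c₁, hrel _ _ _ hid₁, h₁, hfin _ _ _ hid₁ h₁, hO₁, hv₁⟩

/-- The main inequality for two solutions of `x + y = 1` whose logarithms are almost proportional
with ratio `2 * n + 1`. -/
theorem unit_gap_inequality {L : Type*} [Field L] [CharZero L] {T : Type*} [Fintype T]
    (v : T → AbsoluteValue L ℝ) (O : Subring L) (hO : ∀ z ∈ O, z ≠ 0 → 1 ≤ ∏ t, v t z)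
    {x y x' y' : L} (hx : x ∈ O) (hxi : x⁻¹ ∈ O) (hx' : x' ∈ O)
    (hx0 : x ≠ 0) (hy0 : y ≠ 0) (hx0' : x' ≠ 0) (hy0' : y' ≠ 0)
    (hxs : ∑ t, Real.log (v t x) = 0) (hys : ∑ t, Real.log (v t y) = 0)
    (hxy : x + y = 1) (hxy' : x' + y' = 1) {n : ℕ} (hn : 1 ≤ n) {E : ℝ} (hE : 0 ≤ E)
    (hEx : ∀ t, Real.log (v t x') - (2 * n + 1) * Real.log (v t x) ≤ E)
    (hEy : ∀ t, Real.log (v t y') - (2 * n + 1) * Real.log (v t y) ≤ E) :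
    (2 * n + 1) * (∑ t, max 0 (Real.log (v t x)) - Fintype.card T * Real.log 2) ≤
      Fintype.card T * ((10 * n + 8) * Real.log 2) +
        (n + 1) * ∑ t, max 0 (Real.log (v t x)) + Fintype.card T * E := by
  set M := 2 * n + 1 with hM
  have hxM := pow_ne_zero M hx0
  have hyM := pow_ne_zero M hy0
  obtain ⟨a, b, c, hrel, ha, hb, hmem, hv⟩ := exists_pade_combination n hn (η := x' / x ^ M)
    (θ := y' / y ^ M) hxy hx0 hy0 (by
      rw [div_mul_cancel₀ _ hxM, div_mul_cancel₀ _ hyM, hxy'])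
  rw [← hM] at hrel
  obtain ⟨haO, hbO, hcO⟩ := hmem O hx
  have hy' : y' ∈ O := by
    rw [show y' = 1 - x' by rw [← hxy']; ring]; exact O.sub_mem O.one_mem hx'
  have hz₁ : a - x' / x ^ M * c ∈ O := by
    refine O.sub_mem haO (O.mul_mem ?_ hcO)
    rw [div_eq_mul_inv, ← inv_pow]
    exact O.mul_mem hx' (O.pow_mem hxi _)
  have hsum := hO _ hz₁ ha
  have hlogsum : 0 ≤ ∑ t, Real.log (v t (a - x' / x ^ M * c)) := by
    rw [← Real.log_prod fun t _ => (v t).ne_zero ha]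
    exact Real.log_nonneg hsum
  have hloc : ∀ t, Real.log (v t (a - x' / x ^ M * c)) + M * Real.log (v t x) ≤
      (10 * n + 8) * Real.log 2 + (n + 1) * max 0 (Real.log (v t x)) + E +
        M * (Real.log (v t x) + Real.log (v t y)) -
        M * (max 0 (Real.log (v t x)) - Real.log 2) := by
    intro t
    have px : 0 < v t x := (v t).pos hx0
    have py : 0 < v t y := (v t).pos hy0
    have hmaxpos : 0 < max 1 (v t x) := by positivity
    have hlogmax : Real.log (max 1 (v t x)) = max 0 (Real.log (v t x)) := by
      rcases le_total 1 (v t x) with h | h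
      · rw [max_eq_right h, max_eq_right (Real.log_nonneg h)]
      · rw [max_eq_left h, max_eq_left (Real.log_nonpos px.le h), Real.log_one]
    have bound : ∀ w w' d : L, w ≠ 0 → w' ≠ 0 → d - w' / w ^ M * c ≠ 0 → v t d ≤
          8 ^ (3 * n + 2) * 2 ^ (n + 1) * max 1 (v t x) ^ (n + 1) →
        Real.log (v t w') - (2 * n + 1) * Real.log (v t w) ≤ E →
        Real.log (v t (d - w' / w ^ M * c)) ≤
          (10 * n + 8) * Real.log 2 + (n + 1) * max 0 (Real.log (v t x)) + E := by
      intro w w' d hw hw' hd hvd hwE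
      have hE1 : (1 : ℝ) ≤ Real.exp E := Real.one_le_exp hE
      have h1 : v t (w' / w ^ M) ≤ Real.exp E := by
        rw [← Real.log_le_iff_le_exp ((v t).pos (div_ne_zero hw' (pow_ne_zero _ hw))), map_div₀,
          map_pow, Real.log_div ((v t).ne_zero hw') (pow_ne_zero _ ((v t).ne_zero hw)), Real.log_pow]
        push_cast [hM]
        exact hwE
      set Q := (8 : ℝ) ^ (3 * n + 2) * 2 ^ (n + 1) * max 1 (v t x) ^ (n + 1) with hQ
      have hQ0 : 0 < Q := by positivity
      have hc := (le_max_right _ _).trans ((le_max_right _ _).trans (hv (v t)))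
      have h2 : v t (d - w' / w ^ M * c) ≤ 2 * Q * Real.exp E := by
        refine ((v t).sub_le_add _ _).trans ?_
        rw [map_mul]
        have := mul_le_mul h1 hc ((v t).nonneg c) (Real.exp_pos E).le
        nlinarith
      have h3 := Real.log_le_log ((v t).pos hd) h2
      rw [Real.log_mul (by positivity) (by positivity), Real.log_mul (by positivity) (by positivity),
        Real.log_exp, hQ, Real.log_mul (by positivity) (by positivity),
        Real.log_mul (by positivity) (by positivity), Real.log_pow, Real.log_pow, Real.log_pow,
        hlogmax, show (8 : ℝ) = 2 ^ 3 by norm_num, Real.log_pow] at h3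
      push_cast at h3
      linarith
    have b1 := bound x x' a hx0 hx0' ha ((le_max_left _ _).trans (hv (v t))) (hEx t)
    have b2 := bound y y' b hy0 hy0' hb
      ((le_max_left _ _).trans ((le_max_right _ _).trans (hv (v t)))) (hEy t)
    have heq : Real.log (v t (a - x' / x ^ M * c)) + M * Real.log (v t x) =
        Real.log (v t (b - y' / y ^ M * c)) + M * Real.log (v t y) := by
      have := congrArg (v t) (eq_neg_of_add_eq_zero_left hrel)
      rw [AbsoluteValue.map_neg, map_mul, map_mul, map_pow, map_pow] at this
      rw [← Real.log_pow, ← Real.log_pow, ← Real.log_mul ((v t).ne_zero ha)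
        (pow_ne_zero _ px.ne'), ← Real.log_mul ((v t).ne_zero hb) (pow_ne_zero _ py.ne'), this]
    have hmax : max 0 (Real.log (v t x)) - Real.log 2 ≤ max (Real.log (v t x)) (Real.log (v t y)) := by
      have hl2 : 0 ≤ Real.log 2 := Real.log_nonneg (by norm_num)
      have h1 : 1 ≤ v t x + v t y := by
        have := (v t).add_le x y
        rwa [hxy, map_one] at this
      rcases le_total (v t x) (v t y) with h | h
      · have h4 := Real.log_le_log one_pos (show (1 : ℝ) ≤ 2 * v t y by linarith)
        rw [Real.log_one, Real.log_mul (by norm_num) py.ne'] at h4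
        rw [max_eq_right (Real.log_le_log px h)]
        have := Real.log_le_log px h
        rw [sub_le_iff_le_add]
        exact max_le (by linarith) (by linarith)
      · have h4 := Real.log_le_log one_pos (show (1 : ℝ) ≤ 2 * v t x by linarith)
        rw [Real.log_one, Real.log_mul (by norm_num) px.ne'] at h4
        rw [max_eq_left (Real.log_le_log py h)]
        rw [sub_le_iff_le_add]
        exact max_le (by linarith) (by linarith)
    have hM0 : (0 : ℝ) ≤ M := Nat.cast_nonneg _
    rcases le_total (Real.log (v t x)) (Real.log (v t y)) with h | h
    · rw [max_eq_right h] at hmax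
      have := mul_le_mul_of_nonneg_left hmax hM0
      linarith
    · rw [max_eq_left h] at hmax
      have := mul_le_mul_of_nonneg_left hmax hM0
      linarith
  have htot := Finset.sum_le_sum fun t (_ : t ∈ Finset.univ) => hloc t
  simp only [Finset.sum_add_distrib, Finset.sum_sub_distrib, ← Finset.mul_sum, hxs, hys,
    Finset.sum_const, Finset.card_univ, nsmul_eq_mul, mul_zero, add_zero] at htot
  have hMc : (M : ℝ) = 2 * n + 1 := by push_cast [hM]; ring
  rw [hMc] at htot
  linarith

theorem sum_log_eq_zero_of_unit {L : Type*} [Field L] {T : Type*} [Fintype T]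
    (v : T → AbsoluteValue L ℝ) (O : Subring L) (hO : ∀ z ∈ O, z ≠ 0 → 1 ≤ ∏ t, v t z)
    {x : L} (hx : x ∈ O) (hxi : x⁻¹ ∈ O) (hx0 : x ≠ 0) : ∑ t, Real.log (v t x) = 0 := by
  have h : ∀ z ∈ O, z ≠ 0 → 0 ≤ ∑ t, Real.log (v t z) := fun z hz hz0 => by
    rw [← Real.log_prod fun t _ => (v t).ne_zero hz0]
    exact Real.log_nonneg (hO z hz hz0)
  refine le_antisymm ?_ (h x hx hx0)
  have := h _ hxi (inv_ne_zero hx0)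
  simp only [map_inv₀, Real.log_inv, Finset.sum_neg_distrib] at this
  linarith

theorem abs_le_sum_max_zero {T : Type*} [Fintype T] (f : T → ℝ) (hf : ∑ t, f t = 0) (t : T) :
    |f t| ≤ ∑ s, max 0 (f s) := by
  classical
  have h1 : f t ≤ ∑ s, max 0 (f s) := (le_max_right _ _).trans
    (Finset.single_le_sum (f := fun s => max 0 (f s)) (fun s _ => le_max_left _ _)
      (Finset.mem_univ t))
  refine abs_le'.mpr ⟨h1, ?_⟩
  rw [← Finset.add_sum_erase _ _ (Finset.mem_univ t)] at hf
  rw [← Finset.add_sum_erase _ _ (Finset.mem_univ t)]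
  have := Finset.sum_le_sum fun s (_ : s ∈ Finset.univ.erase t) => le_max_right 0 (f s)
  linarith [le_max_left 0 (f t)]

/-- From an infinite set and a map to a finite-dimensional space whose norm is unbounded on every
infinite subset, extract two elements of nearly the same direction and a prescribed gap in norm. -/
theorem exists_pair_almost_proportional {X ι : Type*} [Fintype ι] (ξ : X → ι → ℝ) {S : Set X}
    (hS : S.Infinite) (hB : ∀ B : ℝ, {x ∈ S | ‖ξ x‖ ≤ B}.Finite) {ε : ℝ} (hε : 0 < ε) (A : ℝ)
    (m : ℕ) : ∃ x ∈ S, ∃ x' ∈ S, ∃ n : ℕ, A < ‖ξ x‖ ∧ 0 < ‖ξ x‖ ∧ m ≤ n ∧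
      ‖ξ x'‖ ≤ (2 * n + 2) * ‖ξ x‖ ∧
      ∀ i, |ξ x' i - (2 * n + 1) * ξ x i| ≤ ε * ‖ξ x'‖ + ‖ξ x‖ := by
  obtain ⟨F, -, hF, hcov⟩ := (isCompact_closedBall (0 : ι → ℝ) 1).finite_cover_balls (half_pos hε)
  set u : X → ι → ℝ := fun x => ‖ξ x‖⁻¹ • ξ x with hu
  have hu1 : ∀ x, ‖u x‖ ≤ 1 := fun x => by
    rw [hu, norm_smul, norm_inv, norm_norm]
    exact inv_mul_le_one
  obtain ⟨c, hc⟩ : ∃ c : ι → ℝ, {x ∈ S | dist (u x) c < ε / 2}.Infinite := by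
    by_contra! hcon
    refine hS ((hF.biUnion fun c _ => hcon c).subset fun x hx => ?_)
    obtain ⟨c, hcF, hxc⟩ := Set.mem_iUnion₂.mp (hcov (show u x ∈ Metric.closedBall 0 1 by
      simpa using hu1 x))
    exact Set.mem_iUnion₂.mpr ⟨c, hcF, hx, hxc⟩
  have hex : ∀ B : ℝ, ∃ x ∈ S, dist (u x) c < ε / 2 ∧ B < ‖ξ x‖ := by
    intro B
    by_contra! hcon
    exact hc ((hB B).subset fun x hx => ⟨hx.1, hcon x hx.1 hx.2⟩)
  obtain ⟨x, hxS, hxc, hxA⟩ := hex (max A 0)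
  have hx0 : 0 < ‖ξ x‖ := (le_max_right _ _).trans_lt hxA
  obtain ⟨x', hxS', hxc', hxA'⟩ := hex (2 * m * ‖ξ x‖)
  have hx0' : 0 < ‖ξ x'‖ := lt_of_le_of_lt (by positivity) hxA'
  have h2 : 0 < 2 * ‖ξ x‖ := by linarith
  set n := ⌊‖ξ x'‖ / (2 * ‖ξ x‖)⌋₊ with hn
  have hn1 : (n : ℝ) * (2 * ‖ξ x‖) ≤ ‖ξ x'‖ := by
    rw [← le_div_iff₀ h2]; exact Nat.floor_le (by positivity)
  have hn2 : ‖ξ x'‖ < (n + 1) * (2 * ‖ξ x‖) := by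
    rw [← div_lt_iff₀ h2]; exact Nat.lt_floor_add_one _
  refine ⟨x, hxS, x', hxS', n, (le_max_left _ _).trans_lt hxA, hx0, ?_, by linarith, fun i => ?_⟩
  · refine Nat.le_floor ?_
    rw [le_div_iff₀ h2]
    linarith
  · have hr : ∀ z, 0 < ‖ξ z‖ → ξ z i = ‖ξ z‖ * u z i := fun z hz => by
      simp only [hu, Pi.smul_apply, smul_eq_mul]
      rw [mul_inv_cancel_left₀ hz.ne']
    have hd : |u x' i - u x i| ≤ ε := by
      have h1 := norm_le_pi_norm (u x' - u x) i
      rw [Pi.sub_apply, Real.norm_eq_abs, ← dist_eq_norm] at h1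
      linarith [dist_triangle_right (u x') (u x) c]
    have hui : |u x i| ≤ 1 := (norm_le_pi_norm (u x) i).trans (hu1 x)
    have hk : |‖ξ x'‖ - (2 * n + 1) * ‖ξ x‖| ≤ ‖ξ x‖ := abs_le.mpr ⟨by linarith, by linarith⟩
    rw [hr x hx0, hr x' hx0', show ‖ξ x'‖ * u x' i - (2 * n + 1) * (‖ξ x‖ * u x i) =
      ‖ξ x'‖ * (u x' i - u x i) + (‖ξ x'‖ - (2 * n + 1) * ‖ξ x‖) * u x i by ring]
    refine (abs_add_le _ _).trans (add_le_add ?_ ?_)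
    · rw [abs_mul, abs_norm, mul_comm]
      exact mul_le_mul_of_nonneg_right hd hx0'.le
    · rw [abs_mul]
      calc _ ≤ ‖ξ x‖ * 1 := mul_le_mul hk hui (abs_nonneg _) hx0.le
        _ = _ := mul_one _

/-- Finiteness of the solutions of the unit equation `x + y = 1` in a subring satisfying a product
inequality and the Northcott property. -/
theorem finite_unit_equation {L : Type*} [Field L] [CharZero L] {T : Type*} [Fintype T]
    (v : T → AbsoluteValue L ℝ) (O : Subring L) (hO : ∀ z ∈ O, z ≠ 0 → 1 ≤ ∏ t, v t z)
    (hN : ∀ B : ℝ, {z : L | z ∈ O ∧ ∀ t, v t z ≤ B}.Finite) :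
    {x : L | x ∈ O ∧ x⁻¹ ∈ O ∧ (1 - x)⁻¹ ∈ O ∧ x ≠ 0 ∧ 1 - x ≠ 0}.Finite := by
  by_contra hinf
  set t := Fintype.card T with ht
  obtain ⟨x, ⟨hx, hxi, hyi, hx0, hy0⟩, x', ⟨hx', hxi', hyi', hx0', hy0'⟩, n, hA, hpos, hm, hle,
    hdiff⟩ := exists_pair_almost_proportional (X := L) (ι := T ⊕ T)
      (fun x => Sum.elim (fun t => Real.log (v t x)) (fun t => Real.log (v t (1 - x)))) hinf
      (fun B => (hN (Real.exp B)).subset fun x ⟨⟨hx, _, _, hx0, _⟩, hxB⟩ => ⟨hx, fun t => by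
        rw [← Real.log_le_iff_le_exp ((v t).pos hx0)]
        exact (le_abs_self _).trans ((norm_le_pi_norm _ (Sum.inl t)).trans hxB)⟩)
      (ε := 1 / (16 * (t + 1))) (by positivity) (36 * t) (8 * t + 8)
  set ξ : L → T ⊕ T → ℝ := fun x =>
    Sum.elim (fun t => Real.log (v t x)) (fun t => Real.log (v t (1 - x))) with hξ
  have hx1 : 1 - x ∈ O := O.sub_mem O.one_mem hx
  have hxs := sum_log_eq_zero_of_unit v O hO hx hxi hx0
  have hys := sum_log_eq_zero_of_unit v O hO hx1 hyi hy0
  set E := 1 / (16 * (t + 1)) * ‖ξ x'‖ + ‖ξ x‖ with hE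
  have hE0 : 0 ≤ E := by positivity
  have main := unit_gap_inequality v O hO hx hxi hx' hx0 hy0 hx0' hy0' hxs hys
    (add_sub_cancel _ _) (add_sub_cancel _ _) (show 1 ≤ n by omega) hE0
    (fun t => (le_abs_self _).trans (hdiff (Sum.inl t)))
    (fun t => (le_abs_self _).trans (hdiff (Sum.inr t)))
  set h := ∑ t, max 0 (Real.log (v t x)) with hh
  rw [← ht] at main
  have hl0 : 0 ≤ Real.log 2 := Real.log_nonneg (by norm_num)
  have hl1 : Real.log 2 ≤ 1 := by linarith [Real.log_two_lt_d9]
  have hh0 : 0 ≤ h := Finset.sum_nonneg fun _ _ => le_max_left _ _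
  have hNh : ‖ξ x‖ ≤ h + t * Real.log 2 := by
    refine (pi_norm_le_iff_of_nonneg (by positivity)).mpr ?_
    rintro (s | s)
    · have := abs_le_sum_max_zero _ hxs s
      rw [Real.norm_eq_abs]
      exact this.trans (le_add_of_nonneg_right (by positivity))
    · refine (abs_le_sum_max_zero _ hys s).trans ?_
      have : ∀ s, max 0 (Real.log (v s (1 - x))) ≤ max 0 (Real.log (v s x)) + Real.log 2 := by
        intro s
        refine max_le (add_nonneg (le_max_left _ _) hl0) ?_
        have px := (v s).pos hx0
        have h1 : v s (1 - x) ≤ 1 + v s x := by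
          simpa using (v s).sub_le_add 1 x
        rcases le_total (v s x) 1 with h2 | h2
        · have := Real.log_le_log ((v s).pos hy0) (show v s (1 - x) ≤ 2 by linarith)
          linarith [le_max_left 0 (Real.log (v s x))]
        · have := Real.log_le_log ((v s).pos hy0) (show v s (1 - x) ≤ v s x * 2 by linarith)
          rw [Real.log_mul px.ne' (by norm_num)] at this
          linarith [le_max_right 0 (Real.log (v s x))]
      refine (Finset.sum_le_sum fun s _ => this s).trans ?_
      rw [Finset.sum_add_distrib, Finset.sum_const, nsmul_eq_mul, Finset.card_univ]
  have ht0 : (0 : ℝ) ≤ t := Nat.cast_nonneg _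
  have hnt : (8 * t + 8 : ℝ) ≤ n := by exact_mod_cast hm
  have hE1 : t * E ≤ (n + 1) / 8 * ‖ξ x‖ + t * ‖ξ x‖ := by
    rw [hE, mul_add]
    refine add_le_add ?_ le_rfl
    have h1 : (t : ℝ) * (1 / (16 * (t + 1))) ≤ 1 / 16 := by
      rw [mul_one_div, div_le_iff₀ (by positivity)]
      linarith
    calc (t : ℝ) * (1 / (16 * (t + 1)) * ‖ξ x'‖) = (t : ℝ) * (1 / (16 * (t + 1))) * ‖ξ x'‖ := by ring
      _ ≤ 1 / 16 * ((2 * n + 2) * ‖ξ x‖) := mul_le_mul h1 hle (norm_nonneg _) (by norm_num)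
      _ = _ := by ring
  have hl2 : t * Real.log 2 ≤ t := mul_le_of_le_one_right ht0 hl1
  have hNt : ‖ξ x‖ ≤ h + t := hNh.trans (by linarith)
  have hl3 : (12 * n + 9) * (t * Real.log 2) ≤ (12 * n + 9) * t :=
    mul_le_mul_of_nonneg_left hl2 (by positivity)
  have h5 : ((n + 1) / 8 + t) * ‖ξ x‖ ≤ (3 / 8 * n) * (h + t) :=
    mul_le_mul (by linarith) hNt hpos.le (by positivity)
  have h6 : n * h ≤ n * (21 * t + 3 / 8 * (h + t)) := by nlinarith
  have h7 := le_of_mul_le_mul_left h6 (by linarith)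
  linarith

namespace NumberField

/-- The ring of elements of `L` integral at all finite places outside `S`. -/
def outsideIntegers {L : Type*} [Field L] [NumberField L] (S : Set (FinitePlace L)) : Subring L where
  carrier := {z | ∀ v ∉ S, v z ≤ 1}
  mul_mem' ha hb v hv := by
    rw [map_mul]
    exact mul_le_one₀ (ha v hv) (apply_nonneg v _) (hb v hv)
  one_mem' v _ := by simp
  add_mem' ha hb v hv := (v.add_le _ _).trans (max_le (ha v hv) (hb v hv))
  zero_mem' v _ := by simp
  neg_mem' ha v hv := (v.1.map_neg _).trans_le (ha v hv)

/-- The infinite places with multiplicity together with the places in `S`. -/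
def placesWith {L : Type*} [Field L] [NumberField L] (S : Finset (FinitePlace L)) :
    (Σ w : InfinitePlace L, Fin w.mult) ⊕ S → AbsoluteValue L ℝ :=
  Sum.elim (fun w => w.1.1) fun s => s.1.1

theorem prod_placesWith {L : Type*} [Field L] [NumberField L] (S : Finset (FinitePlace L))
    (f : AbsoluteValue L ℝ → ℝ) : ∏ t, f (placesWith S t) =
      (∏ w : InfinitePlace L, f w.1 ^ w.mult) * ∏ s ∈ S, f s.1 := by
  rw [Fintype.prod_sum_type, Fintype.prod_sigma]
  congr 1
  · refine Finset.prod_congr rfl fun w _ => ?_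
    simp [placesWith]
  · exact Finset.prod_coe_sort S fun s => f s.1

theorem one_le_prod_placesWith {L : Type*} [Field L] [NumberField L] (S : Finset (FinitePlace L))
    {z : L} (hz : z ∈ outsideIntegers (S : Set (FinitePlace L))) (hz0 : z ≠ 0) :
    1 ≤ ∏ t, placesWith S t z := by
  classical
  rw [prod_placesWith S fun v => v z, ← prod_abs_eq_one hz0]
  refine mul_le_mul_of_nonneg_left ?_ (Finset.prod_nonneg fun w _ => by positivity)
  have hfin : (Function.mulSupport fun w : FinitePlace L => w z).Finite :=
    FinitePlace.hasFiniteMulSupport hz0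
  rw [finprod_eq_prod_of_mulSupport_subset _ (s := S ∪ hfin.toFinset) (by simp),
    ← Finset.prod_sdiff (Finset.subset_union_left (s₁ := S) (s₂ := hfin.toFinset))]
  refine mul_le_of_le_one_left (Finset.prod_nonneg fun s _ => s.1.nonneg z) ?_
  refine Finset.prod_le_one (fun s _ => apply_nonneg s z) fun s hs => hz s ?_
  simpa using (Finset.mem_sdiff.mp hs).2

theorem finite_outsideIntegers_le {L : Type*} [Field L] [NumberField L]
    (S : Finset (FinitePlace L)) (B : ℝ) :
    {z : L | z ∈ outsideIntegers (S : Set (FinitePlace L)) ∧ ∀ t, placesWith S t z ≤ B}.Finite := by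
  refine (finite_setOfPred_mulHeight₁_le L
    (∏ _t : (Σ w : InfinitePlace L, Fin w.mult) ⊕ S, max B 1)).subset fun z ⟨hz, hzB⟩ => ?_
  change Height.mulHeight₁ z ≤ _
  rw [mulHeight₁_eq, finprod_eq_prod_of_mulSupport_subset _ (s := S)]
  · calc _ = ∏ t, max (placesWith S t z) 1 := (prod_placesWith S fun v => max (v z) 1).symm
      _ ≤ _ := Finset.prod_le_prod (fun _ _ => by positivity) fun t _ => max_le_max_right 1 (hzB t)
  · intro v hv
    by_contra hvS
    exact hv (max_eq_right (hz v hvS))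

/-- The `S`-unit equation `x + y = 1` has only finitely many solutions. -/
theorem finite_sUnit_equation {L : Type*} [Field L] [NumberField L] {S : Set (FinitePlace L)}
    (hS : S.Finite) : {x : L | x ≠ 0 ∧ 1 - x ≠ 0 ∧ ∀ v ∉ S, v x = 1 ∧ v (1 - x) = 1}.Finite := by
  refine (finite_unit_equation (placesWith hS.toFinset) (outsideIntegers (hS.toFinset : Set _))
    (fun z hz hz0 => one_le_prod_placesWith _ hz hz0) (finite_outsideIntegers_le _)).subset
    fun x ⟨hx0, hy0, hv⟩ => ?_
  rw [hS.coe_toFinset]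
  exact ⟨fun v h => (hv v h).1.le, fun v h => by simp [hv v h],
    fun v h => by simp [hv v h], hx0, hy0⟩

end NumberField

theorem IsNonarchimedean.abv_sub_eq_left {L : Type*} [Field L] {v : AbsoluteValue L ℝ}
    (hv : IsNonarchimedean v) {x y : L} (h : v y < v x) : v (x - y) = v x := by
  refine le_antisymm ?_ ?_
  · rw [sub_eq_add_neg]
    exact (hv _ _).trans (max_le le_rfl (by rw [v.map_neg]; exact h.le))
  · have := hv (x - y) y
    rw [sub_add_cancel] at this
    exact (le_max_iff.mp this).resolve_right h.not_ge

theorem Multiset.prod_map_abv_lt_one {L : Type*} [Field L] (v : AbsoluteValue L ℝ)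
    {A : Multiset L} {w : L} (h : ∀ r ∈ A, v (w - r) ≤ 1) {r : L} (hr : r ∈ A) (hlt : v (w - r) < 1) :
    v (A.map (w - ·)).prod < 1 := by
  obtain ⟨A, rfl⟩ := Multiset.exists_cons_of_mem hr
  rw [Multiset.map_cons, Multiset.prod_cons, map_mul]
  refine mul_lt_one_of_nonneg_of_lt_one_left (v.nonneg _) hlt ?_
  replace h := fun s hs => h s (Multiset.mem_cons_of_mem hs)
  clear hr
  induction A using Multiset.induction_on with
  | empty => simp
  | cons s A ih =>
    rw [Multiset.map_cons, Multiset.prod_cons, map_mul]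
    exact mul_le_one₀ (h s (Multiset.mem_cons_self s A)) (v.nonneg _)
      (ih fun t ht => h t (Multiset.mem_cons_of_mem ht))

theorem Multiset.prod_map_abv_eq_pow {L : Type*} [Field L] (v : AbsoluteValue L ℝ)
    {A : Multiset L} {w : L} {c : ℝ} (h : ∀ r ∈ A, v (w - r) = c) :
    v (A.map (w - ·)).prod = c ^ card A := by
  induction A using Multiset.induction_on with
  | empty => simp
  | cons s A ih =>
    rw [Multiset.map_cons, Multiset.prod_cons, map_mul, h s (Multiset.mem_cons_self s A),
      ih fun t ht => h t (Multiset.mem_cons_of_mem ht), Multiset.card_cons, pow_succ']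

/-- If `∏ (w - r)` over two disjoint well-spaced families of integral points agree at a
nonarchimedean absolute value, then `w` has the same distance to all these points. -/
theorem IsNonarchimedean.exists_forall_abv_sub_eq {L : Type*} [Field L] {v : AbsoluteValue L ℝ}
    (hv : IsNonarchimedean v) {A B : Multiset L} (hAB : ∀ r ∈ A, r ∉ B)
    (hint : ∀ r ∈ A + B, v r ≤ 1) (hsep : ∀ r ∈ A + B, ∀ s ∈ A + B, r ≠ s → v (r - s) = 1)
    {w : L} (hw : v (A.map (w - ·)).prod = v (B.map (w - ·)).prod) :
    ∃ c : ℝ, (∀ r ∈ A + B, v (w - r) = c) ∧ (Multiset.card A ≠ Multiset.card B → c = 1) := by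
  rcases lt_or_ge 1 (v w) with h1 | h1
  · have hc : ∀ r ∈ A + B, v (w - r) = v w := fun r hr =>
      hv.abv_sub_eq_left ((hint r hr).trans_lt h1)
    refine ⟨v w, hc, fun hcard => absurd ?_ hcard⟩
    rw [Multiset.prod_map_abv_eq_pow v fun r hr => hc r (Multiset.mem_add.mpr (.inl hr)),
      Multiset.prod_map_abv_eq_pow v fun r hr => hc r (Multiset.mem_add.mpr (.inr hr))] at hw
    exact pow_right_injective₀ (by linarith) h1.ne' hw
  · have hle : ∀ r ∈ A + B, v (w - r) ≤ 1 := fun r hr => by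
      rw [sub_eq_add_neg]
      exact (hv _ _).trans (max_le h1 (by rw [v.map_neg]; exact hint r hr))
    have key : ∀ A' B' : Multiset L, (∀ r ∈ A', r ∉ B') → A' ≤ A + B → B' ≤ A + B →
        v (A'.map (w - ·)).prod = v (B'.map (w - ·)).prod → ∀ r ∈ A', v (w - r) = 1 := by
      intro A' B' hdis hA' hB' hw' r hr
      have hrAB := Multiset.mem_of_le hA' hr
      by_contra hne
      have hlt := lt_of_le_of_ne (hle r hrAB) hne
      have hB1 : ∀ s ∈ B', v (w - s) = 1 := fun s hs => by
        have hsAB := Multiset.mem_of_le hB' hs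
        have hrs := hsep s hsAB r hrAB (by rintro rfl; exact hdis _ hr hs)
        have := hv.abv_sub_eq_left (x := s - r) (y := w - r) (by rwa [hrs])
        rw [hrs, sub_sub_sub_cancel_right, v.map_sub] at this
        exact this
      rw [Multiset.prod_map_abv_eq_pow v hB1, one_pow] at hw'
      exact (Multiset.prod_map_abv_lt_one v
        (fun t ht => hle t (Multiset.mem_of_le hA' ht)) hr hlt).ne hw'
    refine ⟨1, fun r hr => ?_, fun _ => rfl⟩
    rcases Multiset.mem_add.mp hr with h | h
    · exact key A B hAB (Multiset.le_add_right _ _) (Multiset.le_add_left _ _) hw r h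
    · exact key B A (fun s hs hs' => hAB s hs' hs) (Multiset.le_add_left _ _)
        (Multiset.le_add_right _ _) hw.symm r h

namespace NumberField

theorem FinitePlace.finite_ne_one {L : Type*} [Field L] [NumberField L] {z : L} (hz : z ≠ 0) :
    {v : FinitePlace L | v z ≠ 1}.Finite :=
  FinitePlace.hasFiniteMulSupport hz

open Polynomial in
/-- If `p / q` has at least three zeros and poles on the projective line, then it takes `S`-unit
values only finitely often. -/
theorem finite_sUnit_values {L : Type*} [Field L] [NumberField L] {p q : L[X]} (hp : p.Splits)
    (hq : q.Splits) (hp0 : p ≠ 0) (hq0 : q ≠ 0) (hpq : ∀ r ∈ p.roots, r ∉ q.roots)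
    (hroots : (p.natDegree ≠ q.natDegree ∧ ∃ a ∈ p.roots + q.roots, ∃ b ∈ p.roots + q.roots, a ≠ b) ∨
      ∃ a ∈ p.roots + q.roots, ∃ b ∈ p.roots + q.roots, ∃ c ∈ p.roots + q.roots,
        a ≠ b ∧ a ≠ c ∧ b ≠ c)
    {S : Set (FinitePlace L)} (hS : S.Finite) :
    {w : L | p.eval w ≠ 0 ∧ q.eval w ≠ 0 ∧ ∀ v ∉ S, v (p.eval w) = v (q.eval w)}.Finite := by
  classical
  set Z := p.roots + q.roots with hZ
  obtain ⟨S', hS', hlp, hlq, hint, hsep, hSS'⟩ : ∃ S' : Set (FinitePlace L), S'.Finite ∧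
      (∀ v ∉ S', v p.leadingCoeff = 1) ∧ (∀ v ∉ S', v q.leadingCoeff = 1) ∧
      (∀ v ∉ S', ∀ r ∈ Z, v r ≤ 1) ∧ (∀ v ∉ S', ∀ r ∈ Z, ∀ s ∈ Z, r ≠ s → v (r - s) = 1) ∧
      S ⊆ S' := by
    refine ⟨S ∪ {v | v p.leadingCoeff ≠ 1} ∪ {v | v q.leadingCoeff ≠ 1} ∪
      (⋃ r ∈ Z.toFinset, {v | ¬ v r ≤ 1}) ∪
      ⋃ r ∈ Z.toFinset, ⋃ s ∈ Z.toFinset, {v | r ≠ s ∧ v (r - s) ≠ 1}, ?_, ?_, ?_, ?_, ?_, ?_⟩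
    · refine (((hS.union (FinitePlace.finite_ne_one (leadingCoeff_ne_zero.mpr hp0))).union
        (FinitePlace.finite_ne_one (leadingCoeff_ne_zero.mpr hq0))).union
        (Z.toFinset.finite_toSet.biUnion fun r _ => ?_)).union
        (Z.toFinset.finite_toSet.biUnion fun r _ => Z.toFinset.finite_toSet.biUnion fun s _ => ?_)
      · by_cases hr : r = 0
        · simp [hr]
        · exact (FinitePlace.finite_ne_one hr).subset fun v hv h => hv h.le
      · by_cases hrs : r = s
        · simp [hrs]
        · exact (FinitePlace.finite_ne_one (sub_ne_zero.mpr hrs)).subset fun v hv => hv.2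
    · intro v hv; by_contra h; exact hv (by simp [h])
    · intro v hv; by_contra h; exact hv (by simp [h])
    · intro v hv r hr
      by_contra h
      refine hv (Or.inl (Or.inr ?_))
      exact Set.mem_iUnion₂.mpr ⟨r, Multiset.mem_toFinset.mpr hr, h⟩
    · intro v hv r hr s hs hrs
      by_contra h
      refine hv (Or.inr ?_)
      exact Set.mem_iUnion₂.mpr ⟨r, Multiset.mem_toFinset.mpr hr,
        Set.mem_iUnion₂.mpr ⟨s, Multiset.mem_toFinset.mpr hs, hrs, h⟩⟩
    · intro v hv; simp [hv]
  have hne : ∀ w, p.eval w ≠ 0 → q.eval w ≠ 0 → ∀ r ∈ Z, w - r ≠ 0 := by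
    intro w hw hw' r hr h
    rw [sub_eq_zero] at h
    subst h
    rcases Multiset.mem_add.mp hr with h | h
    · exact hw (mem_roots hp0 |>.mp h)
    · exact hw' (mem_roots hq0 |>.mp h)
  have hdist : ∀ w, (∀ v ∉ S, v (p.eval w) = v (q.eval w)) → ∀ v ∉ S', ∃ c : ℝ,
      (∀ r ∈ Z, v (w - r) = c) ∧ (p.natDegree ≠ q.natDegree → c = 1) := by
    intro w hw v hv
    have h := hw v fun h => hv (hSS' h)
    rw [hp.eval_eq_prod_roots, hq.eval_eq_prod_roots, map_mul, map_mul, hlp v hv, hlq v hv, one_mul,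
      one_mul] at h
    rw [hp.natDegree_eq_card_roots, hq.natDegree_eq_card_roots]
    exact IsNonarchimedean.exists_forall_abv_sub_eq (v := v.1) v.add_le hpq (hint v hv) (hsep v hv) h
  have hunit := finite_sUnit_equation hS'
  rcases hroots with ⟨hdeg, a, ha, b, hb, hab⟩ | ⟨a, ha, b, hb, c, hc, hab, hac, hbc⟩
  · have hba : b - a ≠ 0 := sub_ne_zero.mpr hab.symm
    have hinj : Function.Injective fun w : L => (w - a) / (b - a) := fun w w' h => by
      simpa [div_left_inj' hba] using h
    refine (hunit.preimage hinj.injOn).subset fun w ⟨hw, hw', hv⟩ => ?_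
    have e : 1 - (w - a) / (b - a) = -(w - b) / (b - a) := by field_simp; ring
    refine ⟨div_ne_zero (hne w hw hw' a ha) hba, ?_, fun v hvS => ?_⟩
    · rw [e]; exact div_ne_zero (neg_ne_zero.mpr (hne w hw hw' b hb)) hba
    · obtain ⟨c, hc, h1⟩ := hdist w hv v hvS
      rw [e, map_div₀, map_div₀, show v (-(w - b)) = v (w - b) from v.1.map_neg _, hc a ha, hc b hb,
        h1 hdeg, hsep v hvS b hb a ha hab.symm]
      simp
  · have hba : b - a ≠ 0 := sub_ne_zero.mpr hab.symm
    have hbc' : b - c ≠ 0 := sub_ne_zero.mpr hbc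
    have hac' : a - c ≠ 0 := sub_ne_zero.mpr hac
    have hinj : Set.InjOn (fun w : L => ((w - a) * (b - c)) / ((w - c) * (b - a))) {w | w - c ≠ 0} := by
      intro w hw w' hw' h
      simp only at h
      have hw : w - c ≠ 0 := hw
      have hw' : w' - c ≠ 0 := hw'
      rw [div_eq_div_iff (mul_ne_zero hw hba) (mul_ne_zero hw' hba)] at h
      have : (w - w') * ((b - c) * (b - a) * (a - c)) = 0 := by linear_combination h
      exact sub_eq_zero.mp ((mul_eq_zero.mp this).resolve_right
        (mul_ne_zero (mul_ne_zero hbc' hba) hac'))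
    refine Set.Finite.of_injOn (t := _) (fun w ⟨hw, hw', hv⟩ => ?_)
      (hinj.mono fun w hw => hne w hw.1 hw.2.1 c hc) hunit
    have hwc := hne w hw hw' c hc
    have e : 1 - (w - a) * (b - c) / ((w - c) * (b - a)) =
        (w - b) * (c - a) / ((w - c) * (b - a)) := by field_simp; ring
    refine ⟨div_ne_zero (mul_ne_zero (hne w hw hw' a ha) hbc') (mul_ne_zero hwc hba), ?_,
      fun v hvS => ?_⟩
    · rw [e]
      exact div_ne_zero (mul_ne_zero (hne w hw hw' b hb) (sub_ne_zero.mpr hac.symm))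
        (mul_ne_zero hwc hba)
    · obtain ⟨d, hd, -⟩ := hdist w hv v hvS
      have hd0 : d ≠ 0 := by rw [← hd c hc]; exact v.1.ne_zero hwc
      rw [e, map_div₀, map_div₀, map_mul, map_mul, map_mul, hd a ha, hd b hb, hd c hc,
        hsep v hvS b hb a ha hab.symm, hsep v hvS b hb c hc hbc, hsep v hvS c hc a ha hac.symm]
      simp [hd0]

end NumberField

open Polynomial in
theorem Polynomial.exists_mem_roots_X_pow_sub_C_ne {L : Type*} [Field L] [CharZero L] {d : ℕ}
    (hd : 2 ≤ d) {a : L} (ha : a ≠ 0) (hs : (X ^ d - C a).Splits) :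
    ∃ r ∈ (X ^ d - C a).roots, ∃ s ∈ (X ^ d - C a).roots, r ≠ s := by
  classical
  have hnd := nodup_roots (separable_X_pow_sub_C a (Nat.cast_ne_zero.mpr (by omega : d ≠ 0)) ha)
  have hcard := hs.natDegree_eq_card_roots
  rw [natDegree_X_pow_sub_C, ← Multiset.toFinset_card_of_nodup hnd] at hcard
  obtain ⟨r, hr, s, hs, hrs⟩ := Finset.one_lt_card.mp (show 1 < _ from by rw [← hcard]; omega)
  exact ⟨r, Multiset.mem_toFinset.mp hr, s, Multiset.mem_toFinset.mp hs, hrs⟩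

open Polynomial in
theorem Polynomial.exists_mem_roots_X_pow_sub_C {L : Type*} [Field L] {d : ℕ}
    (hd : d ≠ 0) {a : L} (hs : (X ^ d - C a).Splits) : ∃ r, r ∈ (X ^ d - C a).roots := by
  refine Multiset.card_pos_iff_exists_mem.mp ?_
  rw [← hs.natDegree_eq_card_roots, natDegree_X_pow_sub_C]
  omega

open Polynomial in
theorem Polynomial.pow_eq_of_mem_roots_X_pow_sub_C {L : Type*} [Field L] {d : ℕ} {a r : L}
    (h : r ∈ (X ^ d - C a).roots) : r ^ d = a := by
  simpa [sub_eq_zero] using (mem_roots'.mp h).2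

open Polynomial in
theorem Polynomial.Splits.eval_eq_of_roots_eq_replicate {L : Type*} [Field L] {p : L[X]}
    (hp : p.Splits) {m : ℕ} {a : L} (h : p.roots = Multiset.replicate m a) (w : L) :
    p.eval w = p.leadingCoeff * (w - a) ^ m := by
  rw [hp.eval_eq_prod_roots, h, Multiset.map_replicate, Multiset.prod_replicate]

namespace NumberField

open Polynomial in
/-- `S`-units in the orbit of a map `w ↦ β * s w ^ d`. -/
theorem finite_sUnit_orbit_of_eq_mul_pow {L : Type*} [Field L] [NumberField L] {β : L} (hβ : β ≠ 0)
    {d : ℕ} (hd : d ≠ 0) {s : L → L} {c : L} (hs : Set.InjOn s {c}ᶜ) {u : ℕ → L}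
    (hu : Function.Injective u) (hstep : ∀ n, u (n + 1) = β * s (u n) ^ d) {A B : L[X]}
    (hA : A.Splits) (hB : B.Splits) (hA0 : A ≠ 0) (hB0 : B ≠ 0) (hAB : ∀ r ∈ A.roots, r ∉ B.roots)
    (hroots : (A.natDegree ≠ B.natDegree ∧ ∃ a ∈ A.roots + B.roots, ∃ b ∈ A.roots + B.roots, a ≠ b) ∨
      ∃ a ∈ A.roots + B.roots, ∃ b ∈ A.roots + B.roots, ∃ c ∈ A.roots + B.roots,
        a ≠ b ∧ a ≠ c ∧ b ≠ c)
    (heval : ∀ t, s (β * t ^ d) ≠ 0 → A.eval t ≠ 0 ∧ B.eval t ≠ 0 ∧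
      ∀ v : FinitePlace L, v β = 1 → v (s (β * t ^ d)) = 1 → v (A.eval t) = v (B.eval t))
    {S : Set (FinitePlace L)} (hS : S.Finite) :
    {n : ℕ | u (n + 2) ≠ 0 ∧ ∀ v ∉ S, v (u (n + 2)) = 1}.Finite := by
  have hfin := finite_sUnit_values hA hB hA0 hB0 hAB hroots (hS.union (FinitePlace.finite_ne_one hβ))
  have h1 : {n : ℕ | u n = c}.Finite :=
    Set.Subsingleton.finite fun m hm n hn => hu (hm.trans hn.symm)
  refine (h1.union (Set.Finite.of_injOn (f := fun n => s (u n)) (s := {n | u n ≠ c ∧ u (n + 2) ≠ 0 ∧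
    ∀ v ∉ S, v (u (n + 2)) = 1}) (t := _) ?_ ?_ hfin)).subset fun n hn => ?_
  · rintro n ⟨-, hn0, hn⟩
    rw [hstep (n + 1), hstep n] at hn0 hn
    have hs0 : s (β * s (u n) ^ d) ≠ 0 := fun h => hn0 (by rw [h, zero_pow hd, mul_zero])
    obtain ⟨h1, h2, h3⟩ := heval _ hs0
    refine ⟨h1, h2, fun v hv => ?_⟩
    have hvβ : v β = 1 := by
      by_contra h
      exact hv (Or.inr h)
    have := hn v fun h => hv (Or.inl h)
    rw [map_mul, hvβ, one_mul, map_pow, pow_eq_one_iff_of_nonneg (apply_nonneg v _) hd] at this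
    exact h3 v hvβ this
  · exact fun m hm n hn h => hu (hs hm.1 hn.1 h)
  · by_cases h : u n = c
    · exact Or.inl h
    · exact Or.inr ⟨h, hn⟩

open Polynomial in
/-- The orbit of a point under a rational map `p / q` of degree at least two, not of the form
`β X ^ (± d)`, contains only finitely many `S`-units. -/
theorem finite_sUnit_orbit {L : Type*} [Field L] [NumberField L] {p q : L[X]} (hp : p.Splits)
    (hq : q.Splits) (hp0 : p ≠ 0) (hq0 : q ≠ 0) (hpq : ∀ r ∈ p.roots, r ∉ q.roots) {d : ℕ}
    (hd : d = max p.natDegree q.natDegree) (hd2 : 2 ≤ d)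
    (hform : ∃ r ∈ p.roots + q.roots, r ≠ 0)
    (hsplit : ∀ r ∈ p.roots + q.roots, (X ^ d - C (r / (p.leadingCoeff / q.leadingCoeff))).Splits)
    {u : ℕ → L} (hu : Function.Injective u) (hstep : ∀ n, u (n + 1) = p.eval (u n) / q.eval (u n))
    {S : Set (FinitePlace L)} (hS : S.Finite) :
    {n : ℕ | u n ≠ 0 ∧ ∀ v ∉ S, v (u n) = 1}.Finite := by
  suffices h : {n : ℕ | u (n + 2) ≠ 0 ∧ ∀ v ∉ S, v (u (n + 2)) = 1}.Finite by
    refine ((Set.finite_lt_nat 2).union (h.image (· + 2))).subset fun n hn => ?_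
    rcases lt_or_ge n 2 with h2 | h2
    · exact Or.inl h2
    · obtain ⟨m, rfl⟩ := Nat.exists_eq_add_of_le' h2
      exact Or.inr ⟨m, hn, rfl⟩
  by_cases hroots : (p.natDegree ≠ q.natDegree ∧
      ∃ a ∈ p.roots + q.roots, ∃ b ∈ p.roots + q.roots, a ≠ b) ∨
      ∃ a ∈ p.roots + q.roots, ∃ b ∈ p.roots + q.roots, ∃ c ∈ p.roots + q.roots,
        a ≠ b ∧ a ≠ c ∧ b ≠ c
  · refine Set.Finite.of_injOn (f := fun n => u (n + 1)) (t := _) ?_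
      (fun m _ n _ h => Nat.succ_injective (hu h))
      (finite_sUnit_values hp hq hp0 hq0 hpq hroots hS)
    rintro n ⟨hn0, hn⟩
    rw [hstep (n + 1)] at hn0 hn
    obtain ⟨h1, h2⟩ := div_ne_zero_iff.mp hn0
    refine ⟨h1, h2, fun v hv => ?_⟩
    have hv2 : v (q.eval (u (n + 1))) ≠ 0 := v.1.ne_zero h2
    have := hn v hv
    rwa [map_div₀, div_eq_one_iff_eq hv2] at this
  push Not at hroots
  obtain ⟨hr2, hr3⟩ := hroots
  have hd0 : d ≠ 0 := by omega
  set β := p.leadingCoeff / q.leadingCoeff with hβ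
  have hβ0 : β ≠ 0 := div_ne_zero (leadingCoeff_ne_zero.mpr hp0) (leadingCoeff_ne_zero.mpr hq0)
  have hpc := hp.natDegree_eq_card_roots
  have hqc := hq.natDegree_eq_card_roots
  have hX : ∀ r : L, X ^ d - C r ≠ 0 := X_pow_sub_C_ne_zero (by omega)
  by_cases hdeg : p.natDegree = q.natDegree
  · obtain ⟨P, hP⟩ := Multiset.card_pos_iff_exists_mem.mp (show 0 < p.roots.card by omega)
    obtain ⟨Q, hQ⟩ := Multiset.card_pos_iff_exists_mem.mp (show 0 < q.roots.card by omega)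
    have hP' : P ∈ p.roots + q.roots := Multiset.mem_add.mpr (.inl hP)
    have hQ' : Q ∈ p.roots + q.roots := Multiset.mem_add.mpr (.inr hQ)
    have hPQ : P ≠ Q := fun h => hpq P hP (h ▸ hQ)
    have hpr : p.roots = Multiset.replicate d P := by
      refine Multiset.eq_replicate.mpr ⟨by omega, fun r hr => ?_⟩
      by_contra h
      exact hPQ (hr3 r (Multiset.mem_add.mpr (.inl hr)) P hP' Q hQ' h
        fun hrQ => hpq r hr (hrQ ▸ hQ))
    have hqr : q.roots = Multiset.replicate d Q := by
      refine Multiset.eq_replicate.mpr ⟨by omega, fun r hr => ?_⟩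
      by_contra h
      exact hPQ (hr3 r (Multiset.mem_add.mpr (.inr hr)) Q hQ' P hP' h
        fun hrP => hpq P hP (hrP ▸ hr)).symm
    have hdis : ∀ r ∈ (X ^ d - C (P / β)).roots, r ∉ (X ^ d - C (Q / β)).roots := by
      intro r hr hr'
      have := (pow_eq_of_mem_roots_X_pow_sub_C hr).symm.trans (pow_eq_of_mem_roots_X_pow_sub_C hr')
      exact hPQ ((div_left_inj' hβ0).mp this)
    have hthree : ∃ a ∈ (X ^ d - C (P / β)).roots + (X ^ d - C (Q / β)).roots,
        ∃ b ∈ (X ^ d - C (P / β)).roots + (X ^ d - C (Q / β)).roots,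
        ∃ c ∈ (X ^ d - C (P / β)).roots + (X ^ d - C (Q / β)).roots, a ≠ b ∧ a ≠ c ∧ b ≠ c := by
      by_cases hP0 : P = 0
      · have hQ0 : Q ≠ 0 := fun h => hPQ (hP0.trans h.symm)
        obtain ⟨a, ha, b, hb, hab⟩ :=
          exists_mem_roots_X_pow_sub_C_ne hd2 (div_ne_zero hQ0 hβ0) (hsplit Q hQ')
        obtain ⟨c, hc⟩ := exists_mem_roots_X_pow_sub_C hd0 (hsplit P hP')
        exact ⟨a, Multiset.mem_add.mpr (.inr ha), b, Multiset.mem_add.mpr (.inr hb), c,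
          Multiset.mem_add.mpr (.inl hc), hab, fun h => hdis c hc (h ▸ ha),
          fun h => hdis c hc (h ▸ hb)⟩
      · obtain ⟨a, ha, b, hb, hab⟩ :=
          exists_mem_roots_X_pow_sub_C_ne hd2 (div_ne_zero hP0 hβ0) (hsplit P hP')
        obtain ⟨c, hc⟩ := exists_mem_roots_X_pow_sub_C hd0 (hsplit Q hQ')
        exact ⟨a, Multiset.mem_add.mpr (.inl ha), b, Multiset.mem_add.mpr (.inl hb), c,
          Multiset.mem_add.mpr (.inr hc), hab, fun h => hdis a ha (h ▸ hc),
          fun h => hdis b hb (h ▸ hc)⟩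
    refine finite_sUnit_orbit_of_eq_mul_pow hβ0 hd0 (s := fun w => (w - P) / (w - Q)) (c := Q) ?_
      hu (fun n => ?_) (hsplit P hP') (hsplit Q hQ') (hX _) (hX _) hdis (.inr hthree) (fun t ht => ?_) hS
    · intro w hw w' hw' h
      have hw : w - Q ≠ 0 := sub_ne_zero.mpr hw
      have hw' : w' - Q ≠ 0 := sub_ne_zero.mpr hw'
      simp only at h
      rw [div_eq_div_iff hw hw'] at h
      have : (w - w') * (P - Q) = 0 := by linear_combination h
      exact sub_eq_zero.mp ((mul_eq_zero.mp this).resolve_right (sub_ne_zero.mpr hPQ))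
    · rw [hstep, hp.eval_eq_of_roots_eq_replicate hpr, hq.eval_eq_of_roots_eq_replicate hqr, hβ,
        div_pow, mul_div_mul_comm]
    · obtain ⟨h1, h2⟩ := div_ne_zero_iff.mp ht
      have e : ∀ r, (X ^ d - C (r / β)).eval t = (β * t ^ d - r) / β := fun r => by
        simp only [eval_sub, eval_pow, eval_X, eval_C]
        field_simp
      rw [e, e]
      refine ⟨div_ne_zero h1 hβ0, div_ne_zero h2 hβ0, fun v _ hv => ?_⟩
      have hv2 : v (β * t ^ d - Q) ≠ 0 := v.1.ne_zero h2
      rw [map_div₀, div_eq_one_iff_eq hv2] at hv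
      rw [map_div₀ v (β * t ^ d - P), map_div₀ v (β * t ^ d - Q), hv]
  · obtain ⟨P, hP, hP0⟩ := hform
    have hone : ∀ (s : L → L), Function.Injective s → (∀ n, u (n + 1) = β * s (u n) ^ d) →
        (∀ w, s w ≠ 0 → w - P ≠ 0) → (∀ (v : FinitePlace L) w, v (s w) = 1 → v (w - P) = 1) →
        {n : ℕ | u (n + 2) ≠ 0 ∧ ∀ v ∉ S, v (u (n + 2)) = 1}.Finite := by
      intro s hs hsu hs0 hsv
      refine finite_sUnit_orbit_of_eq_mul_pow hβ0 hd0 (s := s) (c := 0) hs.injOn hu hsu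
        (hsplit P hP) (Splits.one (R := L)) (hX _) one_ne_zero (by simp) (.inl ⟨?_, ?_⟩) (fun t ht => ?_) hS
      · rwa [natDegree_X_pow_sub_C, natDegree_one]
      · rw [roots_one, Multiset.empty_eq_zero, add_zero]
        exact exists_mem_roots_X_pow_sub_C_ne hd2 (div_ne_zero hP0 hβ0) (hsplit P hP)
      · have e : (X ^ d - C (P / β)).eval t = (β * t ^ d - P) / β := by
          simp only [eval_sub, eval_pow, eval_X, eval_C]
          field_simp
        rw [e]
        refine ⟨div_ne_zero (hs0 _ ht) hβ0, by simp, fun v hvβ hv => ?_⟩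
        simp [hvβ, hsv v _ hv]
    have hall : ∀ r ∈ p.roots + q.roots, r = P := fun r hr => hr2 hdeg r hr P hP
    rcases Multiset.mem_add.mp hP with hPp | hPq
    · have hq1 : q.roots = Multiset.replicate 0 P := by
        refine Multiset.eq_zero_of_forall_notMem fun r hr => hpq P hPp ?_
        rwa [← hall r (Multiset.mem_add.mpr (.inr hr))]
      rw [hq1, Multiset.card_replicate] at hqc
      have hpr : p.roots = Multiset.replicate d P :=
        Multiset.eq_replicate.mpr ⟨by omega, fun r hr => hall r (Multiset.mem_add.mpr (.inl hr))⟩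
      refine hone (fun w => w - P) (sub_left_injective) (fun n => ?_) (fun w hw => hw)
        fun v w hw => hw
      rw [hstep, hp.eval_eq_of_roots_eq_replicate hpr, hq.eval_eq_of_roots_eq_replicate hq1, hβ,
        pow_zero, mul_one, mul_div_right_comm]
    · have hp1 : p.roots = Multiset.replicate 0 P := by
        refine Multiset.eq_zero_of_forall_notMem fun r hr => hpq r hr ?_
        rwa [hall r (Multiset.mem_add.mpr (.inl hr))]
      rw [hp1, Multiset.card_replicate] at hpc
      have hqr : q.roots = Multiset.replicate d P :=
        Multiset.eq_replicate.mpr ⟨by omega, fun r hr => hall r (Multiset.mem_add.mpr (.inr hr))⟩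
      refine hone (fun w => (w - P)⁻¹) (inv_injective.comp sub_left_injective) (fun n => ?_)
        (fun w hw => by simpa using hw) fun v w hw => by simpa using hw
      rw [hstep, hp.eval_eq_of_roots_eq_replicate hp1, hq.eval_eq_of_roots_eq_replicate hqr, hβ,
        pow_zero, inv_pow, mul_div_mul_comm, one_div]

end NumberField

/-- Finitely many algebraic numbers lie in a common number field. -/
theorem AlgebraicClosure.exists_numberField_le (F : Finset (AlgebraicClosure ℚ)) :
    ∃ L : IntermediateField ℚ (AlgebraicClosure ℚ), NumberField L ∧ ∀ x ∈ F, x ∈ L := by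
  have : FiniteDimensional ℚ (IntermediateField.adjoin ℚ (F : Set (AlgebraicClosure ℚ))) :=
    IntermediateField.finiteDimensional_adjoin fun x _ =>
      ((AlgebraicClosure.isAlgebraic ℚ).isAlgebraic x).isIntegral
  exact ⟨IntermediateField.adjoin ℚ F, ⟨⟩, fun x hx => IntermediateField.subset_adjoin ℚ _ hx⟩

open Polynomial in
theorem Polynomial.exists_map_subtype_eq {k E : Type*} [Field k] [Field E] [Algebra k E]
    (L : IntermediateField k E) {p : E[X]} (hp : ∀ c ∈ p.coeffs, c ∈ L) :
    ∃ p' : L[X], p'.map (algebraMap L E) = p := by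
  refine (lifts_iff_coeff_lifts p).mpr fun n => ?_
  by_cases hn : p.coeff n = 0
  · exact ⟨0, by rw [hn, map_zero]⟩
  · exact ⟨⟨_, hp _ (coeff_mem_coeffs hn)⟩, rfl⟩

open Polynomial in
theorem Polynomial.splits_of_roots_map_mem {k E : Type*} [Field k] [Field E] [Algebra k E]
    [IsAlgClosed E] (L : IntermediateField k E) {p : L[X]}
    (hp : ∀ r ∈ (p.map (algebraMap L E)).roots, r ∈ L) : p.Splits :=
  Splits.of_splits_map (algebraMap L E) (IsAlgClosed.splits _) fun r hr => ⟨⟨r, hp r hr⟩, rfl⟩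

open Polynomial NumberField in
theorem finite_multiplicatively_dependent_orbit {p q : (AlgebraicClosure ℚ)[X]} (hp0 : p ≠ 0)
    (hq0 : q ≠ 0) (hpq : ∀ r ∈ p.roots, r ∉ q.roots) (hd : 2 ≤ max p.natDegree q.natDegree)
    (hform : ∃ r ∈ p.roots + q.roots, r ≠ 0) {u : ℕ → AlgebraicClosure ℚ}
    (hu : Function.Injective u) (hstep : ∀ n, u (n + 1) = p.eval (u n) / q.eval (u n))
    (h0 : u 0 ≠ 0) (hroot : ∀ k : ℕ, 0 < k → u 0 ^ k ≠ 1) :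
    {n : ℕ | ∃ k₁ k₂ : ℤ, (k₁, k₂) ≠ (0, 0) ∧ u 0 ^ k₁ * u n ^ k₂ = 1}.Finite := by
  classical
  set d := max p.natDegree q.natDegree with hd'
  set β := p.leadingCoeff / q.leadingCoeff with hβ
  obtain ⟨L, hL, hmem⟩ := AlgebraicClosure.exists_numberField_le
    ({u 0} ∪ p.coeffs ∪ q.coeffs ∪ (p.roots + q.roots).toFinset ∪
      (p.roots + q.roots).toFinset.biUnion fun r => (X ^ d - C (r / β)).roots.toFinset)
  let i := algebraMap L (AlgebraicClosure ℚ)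
  have hi : Function.Injective i := i.injective
  have hrL : ∀ r ∈ p.roots + q.roots, r ∈ L := fun r hr => hmem r (by
    simp only [Finset.mem_union, Multiset.mem_toFinset]
    exact .inl (.inr hr))
  obtain ⟨p, rfl⟩ := exists_map_subtype_eq L (p := p) fun c hc => hmem c (by simp [hc])
  obtain ⟨q, rfl⟩ := exists_map_subtype_eq L (p := q) fun c hc => hmem c (by simp [hc])
  have hps : p.Splits := splits_of_roots_map_mem L fun r hr =>
    hrL r (Multiset.mem_add.mpr (.inl hr))
  have hqs : q.Splits := splits_of_roots_map_mem L fun r hr =>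
    hrL r (Multiset.mem_add.mpr (.inr hr))
  rw [hps.roots_map, hqs.roots_map] at *
  have hp1 : p ≠ 0 := by rintro rfl; simp at hp0
  have hq1 : q ≠ 0 := by rintro rfl; simp at hq0
  have hlift : ∀ n, ∃ x : L, i x = u n := by
    intro n
    induction n with
    | zero => exact ⟨⟨u 0, hmem _ (by simp)⟩, rfl⟩
    | succ n ih =>
      obtain ⟨x, hx⟩ := ih
      refine ⟨p.eval x / q.eval x, ?_⟩
      rw [hstep, ← hx, eval_map_apply, eval_map_apply, map_div₀]
  choose v hv using hlift
  have hv0 : v 0 ≠ 0 := fun h => h0 (by rw [← hv, h, map_zero])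
  have hfin := finite_sUnit_orbit hps hqs hp1 hq1
    (fun r hr hr' => hpq (i r) (Multiset.mem_map_of_mem _ hr) (Multiset.mem_map_of_mem _ hr'))
    (d := d) (by rw [hd', natDegree_map, natDegree_map]) hd
    (by
      obtain ⟨r, hr, hr0⟩ := hform
      rw [← Multiset.map_add] at hr
      obtain ⟨s, hs, rfl⟩ := Multiset.mem_map.mp hr
      exact ⟨s, hs, fun h => hr0 (by rw [h, map_zero])⟩)
    (fun r hr => splits_of_roots_map_mem L fun s hs => hmem s (by
      simp only [Finset.mem_union, Finset.mem_biUnion, Multiset.mem_toFinset]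
      refine .inr ⟨i r, ?_, ?_⟩
      · rw [← Multiset.map_add]
        exact Multiset.mem_map_of_mem _ hr
      · simpa [hβ, leadingCoeff_map, i] using hs))
    (u := v) (fun m n h => hu (by rw [← hv, ← hv, h]))
    (fun n => hi (by
      rw [hv, hstep, ← hv, eval_map_apply, eval_map_apply, map_div₀]))
    (FinitePlace.finite_ne_one hv0)
  refine hfin.subset ?_
  rintro n ⟨k₁, k₂, hk, h⟩
  have hk₂ : k₂ ≠ 0 := by
    rintro rfl
    have hk₁ : k₁ ≠ 0 := fun h => hk (by rw [h])
    rw [zpow_zero, mul_one] at h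
    refine hroot k₁.natAbs (Int.natAbs_pos.mpr hk₁) ?_
    rcases Int.natAbs_eq k₁ with hk' | hk' <;> rw [hk'] at h <;>
      simpa only [zpow_neg, zpow_natCast, inv_eq_one] using h
  replace h : v 0 ^ k₁ * v n ^ k₂ = 1 := hi (by
    rw [map_mul, map_zpow₀, map_zpow₀, hv, hv, h, map_one])
  refine ⟨fun h' => by simp [h', zero_zpow _ hk₂] at h, fun w hw => ?_⟩
  have hw0 : w (v 0) = 1 := by simpa using hw
  have h1 := congrArg w h
  rw [map_mul, map_zpow₀, map_zpow₀, hw0, one_zpow, one_mul, map_one] at h1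
  by_contra hne
  exact hk₂ ((zpow_eq_one_iff_right₀ (apply_nonneg w _) hne).mp h1)

open Polynomial in
theorem Polynomial.eq_C_mul_X_pow_of_roots_map_eq_zero {K E : Type*} [Field K] [Field E]
    [IsAlgClosed E] (σ : K →+* E) {p : K[X]} (hp : ∀ r ∈ (p.map σ).roots, r = 0) :
    p = C p.leadingCoeff * X ^ p.natDegree := by
  refine map_injective σ σ.injective ?_
  have h := IsAlgClosed.splits (p.map σ)
  have hr : (p.map σ).roots = Multiset.replicate p.natDegree 0 :=
    Multiset.eq_replicate.mpr ⟨by rw [← h.natDegree_eq_card_roots, natDegree_map], hp⟩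
  conv_lhs => rw [h.eq_prod_roots, hr, leadingCoeff_map]
  simp

open Polynomial in
theorem RatFunc.exists_mem_roots_ne_zero {K E : Type*} [Field K] [Field E] [IsAlgClosed E]
    (σ : K →+* E) {φ : RatFunc K} (hd : 0 < max φ.num.natDegree φ.denom.natDegree)
    (hform : ∀ β : K, β ≠ 0 →
      φ ≠ RatFunc.C β * RatFunc.X ^ (max φ.num.natDegree φ.denom.natDegree) ∧
      φ ≠ RatFunc.C β / RatFunc.X ^ (max φ.num.natDegree φ.denom.natDegree)) :
    ∃ r ∈ (φ.num.map σ).roots + (φ.denom.map σ).roots, r ≠ 0 := by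
  by_contra! h
  have hφ : φ.num ≠ 0 := by
    intro h0
    have := RatFunc.num_eq_zero_iff.mp h0
    simp [this] at hd
  have hnum := eq_C_mul_X_pow_of_roots_map_eq_zero σ fun r hr =>
    h r (Multiset.mem_add.mpr (.inl hr))
  have hden := eq_C_mul_X_pow_of_roots_map_eq_zero σ fun r hr =>
    h r (Multiset.mem_add.mpr (.inr hr))
  rw [(RatFunc.monic_denom φ).leadingCoeff, map_one, one_mul] at hden
  have heq := RatFunc.num_div_denom φ
  have hβ := leadingCoeff_ne_zero.mpr hφ
  obtain ⟨hβ1, hβ2⟩ := hform _ hβ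
  have hcases : φ.num.natDegree = 0 ∨ φ.denom.natDegree = 0 := by
    by_contra! hne
    have hX : IsUnit (Polynomial.X : K[X]) := (RatFunc.isCoprime_num_denom φ).isUnit_of_dvd'
      (hnum ▸ dvd_mul_of_dvd_right (dvd_pow_self _ hne.1) _)
      (hden ▸ dvd_pow_self _ hne.2)
    exact Polynomial.not_isUnit_X hX
  rcases hcases with h0 | h0
  · refine hβ2 ?_
    rw [h0, Nat.zero_max]
    conv_lhs => rw [← heq, hnum, hden, h0]
    simp
  · refine hβ1 ?_
    rw [h0, Nat.max_zero]
    conv_lhs => rw [← heq, hnum, hden, h0]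
    simp

/-- Let `K` be a number field and `φ ∈ K(X)` of degree `d ≥ 2` not of the form `β X^{± d}`
with `β ∈ K*`, and let `α ∈ ℚ̄`, not a root of unity, be a non-preperiodic point of `φ`
(its orbit points are pairwise distinct). Then there are only finitely many positive
integers `n` such that `α` and `φ^{(n)}(α)` are multiplicatively dependent. -/
theorem stmt_14 {K : Type} [Field K] [NumberField K] (φ : RatFunc K)
    (hd : 2 ≤ max φ.num.natDegree φ.denom.natDegree)
    (hform : ∀ β : K, β ≠ 0 →
      φ ≠ RatFunc.C β * RatFunc.X ^ (max φ.num.natDegree φ.denom.natDegree) ∧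
      φ ≠ RatFunc.C β / RatFunc.X ^ (max φ.num.natDegree φ.denom.natDegree))
    (σ : K →+* AlgebraicClosure ℚ) (α : AlgebraicClosure ℚ) (hα0 : α ≠ 0)
    (hroot : ∀ k : ℕ, 0 < k → α ^ k ≠ 1)
    (hinj : Function.Injective fun n : ℕ => (fun x => RatFunc.eval σ x φ)^[n] α) :
    {n : ℕ | 0 < n ∧ ∃ k₁ k₂ : ℤ, (k₁, k₂) ≠ (0, 0) ∧
      α ^ k₁ * ((fun x => RatFunc.eval σ x φ)^[n] α) ^ k₂ = 1}.Finite := by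
  have hφ : φ.num ≠ 0 := fun h0 => by
    simp [RatFunc.num_eq_zero_iff.mp h0] at hd
  have hstep (x : AlgebraicClosure ℚ) : RatFunc.eval σ x φ =
      (φ.num.map σ).eval x / (φ.denom.map σ).eval x := by
    rw [Polynomial.eval_map, Polynomial.eval_map, RatFunc.eval]
  refine (finite_multiplicatively_dependent_orbit (p := φ.num.map σ) (q := φ.denom.map σ)
    ((Polynomial.map_ne_zero_iff σ.injective).mpr hφ)
    ((Polynomial.map_ne_zero_iff σ.injective).mpr φ.denom_ne_zero)
    (fun r hr hr' => ?_) (by rwa [Polynomial.natDegree_map, Polynomial.natDegree_map])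
    (RatFunc.exists_mem_roots_ne_zero σ (by omega) hform) hinj
    (fun n => by rw [Function.iterate_succ_apply', hstep]) hα0 hroot).subset fun n hn => hn.2
  obtain ⟨a, b, hab⟩ := (RatFunc.isCoprime_num_denom φ).map (Polynomial.mapRingHom σ)
  have h := congrArg (Polynomial.eval r) hab
  simp only [Polynomial.coe_mapRingHom, Polynomial.eval_add, Polynomial.eval_mul,
    (Polynomial.mem_roots'.mp hr).2.eq_zero, (Polynomial.mem_roots'.mp hr').2.eq_zero] at h
  simp at h
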